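/- Let z₀ = π/2 + iπ/2 and z₁ = π/2 − iπ/2 be the upper and lower vertices of D. If f is holomorphic on D and ∫_D |f(z)|² · |z − z₀|^{−2} |z − z₁|^{−2} dA(z) < ∞, then f belongs to A²(Δ) + A²(π − Δ), i.e., there exist f₁ ∈ A²(Δ) and f₂ ∈ A²(π − Δ) with f = f₁|_D + f₂|_D. -/

import Mathlib

open MeasureTheory Set

noncomputable section

/-- The open sector `Δ = {z : |arg z| < π/4}`. -/
def SectorDelta : Set ℂ := {z : ℂ | 0 < z.re ∧ |z.im| < z.re}

/-- The reflected sector `π − Δ`. -/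
def SectorPiDelta : Set ℂ := (fun z => (Real.pi : ℂ) - z) '' SectorDelta

/-- The open square `D = Δ ∩ (π − Δ)` with vertices `0, π/2 − iπ/2, π, π/2 + iπ/2`. -/
def SquareD : Set ℂ := SectorDelta ∩ SectorPiDelta

/-- Membership in the Bergman space `A²(Ω)`. -/
def MemA2 (Ω : Set ℂ) (f : ℂ → ℂ) : Prop :=
  DifferentiableOn ℂ f Ω ∧ ∫⁻ z in Ω, ENNReal.ofReal (‖f z‖ ^ 2) < ⊤

/-- Membership in the weighted Bergman space `A²(Ω, w)`. -/
def MemA2W (Ω : Set ℂ) (w : ℂ → ℝ) (f : ℂ → ℂ) : Prop :=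
  DifferentiableOn ℂ f Ω ∧ ∫⁻ z in Ω, ENNReal.ofReal (‖f z‖ ^ 2 * w z) < ⊤

/-- `log⁺ t = max (log t) 0`. -/
def logPlus (t : ℝ) : ℝ := Real.log (max t 1)

/-- Starting vertices of the four sides of `∂D`, counterclockwise. -/
def sideStart : Fin 4 → ℂ
  | 0 => 0
  | 1 => ((Real.pi / 2 : ℝ) : ℂ) * (1 - Complex.I)
  | 2 => ((Real.pi : ℝ) : ℂ)
  | 3 => ((Real.pi / 2 : ℝ) : ℂ) * (1 + Complex.I)

/-- Direction vectors of the four sides of `∂D`, counterclockwise. -/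
def sideDir : Fin 4 → ℂ
  | 0 => ((Real.pi / 2 : ℝ) : ℂ) * (1 - Complex.I)
  | 1 => ((Real.pi / 2 : ℝ) : ℂ) * (1 + Complex.I)
  | 2 => ((Real.pi / 2 : ℝ) : ℂ) * (Complex.I - 1)
  | 3 => -(((Real.pi / 2 : ℝ) : ℂ) * (1 + Complex.I))

/-- Parametrization of the `k`-th side of `∂D`. -/
def sidePath (k : Fin 4) (t : ℝ) : ℂ := sideStart k + (t : ℂ) * sideDir k

/-- `g` is arclength-integrable on `∂D` (each side has constant speed). -/
def BoundaryIntegrable (g : ℂ → ℂ) : Prop :=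
  ∀ k : Fin 4, IntervalIntegrable (fun t => ‖g (sidePath k t)‖) volume 0 1

/-- `∫_{∂D} |g| log⁺|g| |du| < ∞` (each side has constant speed). -/
def BoundaryLlogL (g : ℂ → ℂ) : Prop :=
  ∀ k : Fin 4, IntervalIntegrable
    (fun t => ‖g (sidePath k t)‖ * logPlus ‖g (sidePath k t)‖) volume 0 1

/-- The Cauchy integral `(1/(2πi)) ∮_{∂D} g(u)/(u − z) du`, `∂D` counterclockwise. -/
def cauchyD (g : ℂ → ℂ) (z : ℂ) : ℂ :=
  (2 * (Real.pi : ℂ) * Complex.I)⁻¹ *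
    ∑ k : Fin 4, ∫ t in (0:ℝ)..1, g (sidePath k t) * sideDir k / (sidePath k t - z)

/-- The Cauchy transform `(𝒞g)(z) = (1/(iπ)) ∫_ℝ g(t)/(t − z) dt` on the upper half-plane. -/
def cauchyTransform (g : ℝ → ℂ) (z : ℂ) : ℂ :=
  (Complex.I * (Real.pi : ℂ))⁻¹ * ∫ t : ℝ, g t / ((t : ℂ) - z)


lemma wb_mem_sector (z : ℂ) : z ∈ SectorDelta ↔ |z.im| < z.re := by
  unfold SectorDelta
  constructor
  · exact fun h => h.2
  · exact fun h => ⟨lt_of_le_of_lt (abs_nonneg _) h, h⟩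

lemma wb_mem_piSector (z : ℂ) : z ∈ SectorPiDelta ↔ |z.im| < Real.pi - z.re := by
  unfold SectorPiDelta
  constructor
  · rintro ⟨w, hw, rfl⟩
    rw [wb_mem_sector] at hw
    simpa using hw
  · intro h
    refine ⟨Real.pi - z, ?_, by ring⟩
    rw [wb_mem_sector]
    simpa using h

lemma wb_mem_square (z : ℂ) : z ∈ SquareD ↔ |z.re - Real.pi / 2| + |z.im| < Real.pi / 2 := by
  unfold SquareD
  rw [mem_inter_iff, wb_mem_sector, wb_mem_piSector]
  constructor
  · rintro ⟨h1, h2⟩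
    rcases abs_cases (z.re - Real.pi / 2) with h | h <;> linarith
  · intro h
    have := neg_abs_le (z.re - Real.pi / 2)
    have := le_abs_self (z.re - Real.pi / 2)
    constructor <;> linarith

lemma wb_isOpen_sector : IsOpen SectorDelta := by
  have : SectorDelta = {z : ℂ | |z.im| < z.re} := by
    ext z; exact wb_mem_sector z
  rw [this]
  exact isOpen_lt (by fun_prop) (by fun_prop)

lemma wb_isOpen_piSector : IsOpen SectorPiDelta := by
  have : SectorPiDelta = {z : ℂ | |z.im| < Real.pi - z.re} := by
    ext z; exact wb_mem_piSector z
  rw [this]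
  exact isOpen_lt (by fun_prop) (by fun_prop)

lemma wb_isOpen_square : IsOpen SquareD := wb_isOpen_sector.inter wb_isOpen_piSector

lemma wb_convex_square : Convex ℝ SquareD := by
  intro z hz w hw a b ha hb hab
  rw [wb_mem_square] at *
  have e1 : (a • z + b • w).re - Real.pi / 2 =
      a * (z.re - Real.pi / 2) + b * (w.re - Real.pi / 2) := by
    simp
    linear_combination (Real.pi / 2) * hab
  have e2 : (a • z + b • w).im = a * z.im + b * w.im := by simp
  rw [e1, e2]
  have h1 := abs_add_le (a * (z.re - Real.pi / 2)) (b * (w.re - Real.pi / 2))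
  have h2 := abs_add_le (a * z.im) (b * w.im)
  simp only [abs_mul, abs_of_nonneg ha, abs_of_nonneg hb] at h1 h2
  have h3 : a * (|z.re - Real.pi / 2| + |z.im|) + b * (|w.re - Real.pi / 2| + |w.im|)
      < Real.pi / 2 := by
    rcases ha.eq_or_lt with h | h
    · subst h
      have : b = 1 := by linarith
      subst this
      linarith
    · have := mul_lt_mul_of_pos_left hz h
      have := mul_le_mul_of_nonneg_left hw.le hb
      have e : a * (Real.pi / 2) + b * (Real.pi / 2) = Real.pi / 2 := by
        rw [← add_mul, hab, one_mul]
      linarith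
  nlinarith

/-- Area sub-mean value property. -/
lemma wb_mean_value (f : ℂ → ℂ) (c : ℂ) (r : ℝ) (hr : 0 < r)
    (hf : DifferentiableOn ℂ f (Metric.ball c r)) :
    ENNReal.ofReal (‖f c‖ ^ 2 * r ^ 2) ≤
      ∫⁻ z in Metric.ball c r, ENNReal.ofReal (‖f z‖ ^ 2) := by
  have hpi := Real.pi_pos
  set F : ℂ → ENNReal := (Metric.ball c r).indicator (fun z => ENNReal.ofReal (‖f z‖ ^ 2)) with hF
  have hFm : Measurable F := by
    have hc : ContinuousOn (fun z => ENNReal.ofReal (‖f z‖ ^ 2)) (Metric.ball c r) :=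
      ENNReal.continuous_ofReal.comp_continuousOn (hf.continuousOn.norm.pow 2)
    classical
    have : F = (Metric.ball c r).piecewise (fun z => ENNReal.ofReal (‖f z‖ ^ 2)) 0 := by
      rw [hF, piecewise_eq_indicator]
    rw [this]
    exact hc.measurable_piecewise continuousOn_const measurableSet_ball
  have hcirc : ∀ ρ ∈ Ioo 0 r, ENNReal.ofReal (2 * Real.pi * ‖f c‖ ^ 2) ≤
      ∫⁻ θ in Ioo (-Real.pi) Real.pi, F (circleMap c ρ θ) := by
    intro ρ hρ
    have hsub : Metric.closedBall c |ρ| ⊆ Metric.ball c r := by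
      rw [abs_of_pos hρ.1]
      exact Metric.closedBall_subset_ball hρ.2
    have hd : DiffContOnCl ℂ (fun z => f z ^ 2) (Metric.ball c |ρ|) := by
      apply DifferentiableOn.diffContOnCl
      exact (hf.pow 2).mono (Metric.closure_ball_subset_closedBall.trans hsub)
    have h1 := hd.circleAverage
    unfold Real.circleAverage at h1
    have hper : Function.Periodic (fun θ => f (circleMap c ρ θ) ^ 2) (2 * Real.pi) := by
      intro θ
      simp only [periodic_circleMap c ρ θ]
    have h2 := hper.intervalIntegral_add_eq 0 (-Real.pi)
    have h3 : ∫ θ in (-Real.pi)..Real.pi, f (circleMap c ρ θ) ^ 2 = (2 * Real.pi) • f c ^ 2 := by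
      rw [← h1, smul_smul, mul_inv_cancel₀ (by positivity), one_smul]
      rw [zero_add, show -Real.pi + 2 * Real.pi = Real.pi by ring] at h2
      exact h2.symm
    rw [intervalIntegral.integral_of_le (by linarith), integral_Ioc_eq_integral_Ioo] at h3
    have h4 := enorm_integral_le_lintegral_enorm (μ := volume.restrict (Ioo (-Real.pi) Real.pi))
      (fun θ => f (circleMap c ρ θ) ^ 2)
    rw [h3] at h4
    calc ENNReal.ofReal (2 * Real.pi * ‖f c‖ ^ 2) = ‖(2 * Real.pi) • f c ^ 2‖ₑ := by
          rw [← ofReal_norm, norm_smul, norm_pow, Real.norm_of_nonneg (by positivity)]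
      _ ≤ _ := h4
      _ ≤ _ := by
          apply lintegral_mono
          intro θ
          have hmem : circleMap c ρ θ ∈ Metric.ball c r := by
            apply hsub
            rw [abs_of_pos hρ.1]
            exact circleMap_mem_closedBall c hρ.1.le θ
          simp only [hF, indicator_of_mem hmem]
          rw [← ofReal_norm, norm_pow]
  have hpolar : ∫⁻ z in Metric.ball c r, ENNReal.ofReal (‖f z‖ ^ 2) =
      ∫⁻ p in Ioi (0 : ℝ) ×ˢ Ioo (-Real.pi) Real.pi,
        ENNReal.ofReal p.1 * F (circleMap c p.1 p.2) := by
    rw [← lintegral_indicator measurableSet_ball]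
    change ∫⁻ z, F z = _
    rw [← lintegral_add_left_eq_self F c, ← Complex.lintegral_comp_polarCoord_symm]
    rw [polarCoord_target]
    apply lintegral_congr
    intro p
    simp only [smul_eq_mul, Complex.polarCoord_symm_apply, circleMap]
    rw [Complex.exp_mul_I]
    simp
  rw [hpolar]
  have hm : Measurable fun p : ℝ × ℝ => ENNReal.ofReal p.1 * F (circleMap c p.1 p.2) := by
    apply Measurable.mul
    · fun_prop
    · apply hFm.comp
      apply Continuous.measurable
      unfold circleMap
      fun_prop
  calc ENNReal.ofReal (‖f c‖ ^ 2 * r ^ 2)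
      ≤ ∫⁻ ρ in Ioo 0 r, ENNReal.ofReal (ρ * (2 * Real.pi * ‖f c‖ ^ 2)) := by
        rw [← ofReal_integral_eq_lintegral_ofReal]
        · apply ENNReal.ofReal_le_ofReal
          rw [← integral_Ioc_eq_integral_Ioo, ← intervalIntegral.integral_of_le hr.le,
            intervalIntegral.integral_mul_const, integral_id]
          have : 0 ≤ ‖f c‖ ^ 2 * r ^ 2 := by positivity
          nlinarith [Real.pi_gt_three]
        · apply IntegrableOn.mono_set _ Ioo_subset_Icc_self
          apply Continuous.integrableOn_Icc
          fun_prop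
        · filter_upwards [ae_restrict_mem measurableSet_Ioo] with ρ hρ
          have := hρ.1
          simp only [Pi.zero_apply]
          positivity
    _ ≤ ∫⁻ ρ in Ioo 0 r, ∫⁻ θ in Ioo (-Real.pi) Real.pi,
          ENNReal.ofReal ρ * F (circleMap c ρ θ) := by
        apply setLIntegral_mono' measurableSet_Ioo
        intro ρ hρ
        rw [lintegral_const_mul']
        · rw [ENNReal.ofReal_mul hρ.1.le]
          gcongr
          exact hcirc ρ hρ
        · exact ENNReal.ofReal_ne_top
    _ ≤ ∫⁻ ρ in Ioi 0, ∫⁻ θ in Ioo (-Real.pi) Real.pi,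
          ENNReal.ofReal ρ * F (circleMap c ρ θ) :=
        lintegral_mono_set Ioo_subset_Ioi_self
    _ = _ := by
        rw [Measure.volume_eq_prod, ← Measure.prod_restrict, lintegral_prod _ hm.aemeasurable]

/-- The family of curves from the lower to the upper vertex. -/
def wbCurve (σ s : ℝ) : ℂ :=
  ((Real.pi / 2 + σ * (Real.cos s / 2) : ℝ) : ℂ) + (s : ℂ) * Complex.I

/-- The derivative of the curves. -/
def wbCurveD (σ s : ℝ) : ℂ :=
  ((-(σ * (Real.sin s / 2)) : ℝ) : ℂ) + Complex.I

lemma wbCurve_re (σ s : ℝ) : (wbCurve σ s).re = Real.pi / 2 + σ * (Real.cos s / 2) := by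
  simp [wbCurve, -Complex.ofReal_add, -Complex.ofReal_mul, -Complex.ofReal_div,
    -Complex.ofReal_cos]

lemma wbCurve_im (σ s : ℝ) : (wbCurve σ s).im = s := by
  simp [wbCurve, -Complex.ofReal_add, -Complex.ofReal_mul, -Complex.ofReal_div,
    -Complex.ofReal_cos]

lemma wbCurve_hasDerivAt (σ s : ℝ) : HasDerivAt (wbCurve σ) (wbCurveD σ s) s := by
  have h1 : HasDerivAt (fun s : ℝ => Real.pi / 2 + σ * (Real.cos s / 2))
      (-(σ * (Real.sin s / 2))) s := by
    have := (((Real.hasDerivAt_cos s).div_const 2).const_mul σ).const_add (Real.pi / 2)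
    exact this.congr_deriv (by ring)
  have h2 : HasDerivAt (fun s : ℝ => (s : ℂ) * Complex.I) Complex.I s := by
    simpa using (Complex.ofRealCLM.hasDerivAt (x := s)).mul_const Complex.I
  exact h1.ofReal_comp.add h2

lemma wbCurve_hasDerivAt_param (σ s : ℝ) :
    HasDerivAt (fun σ => wbCurve σ s) ((Real.cos s / 2 : ℝ) : ℂ) σ := by
  have h1 : HasDerivAt (fun σ : ℝ => Real.pi / 2 + σ * (Real.cos s / 2))
      (Real.cos s / 2) σ := by
    simpa using ((hasDerivAt_id σ).mul_const (Real.cos s / 2)).const_add (Real.pi / 2)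
  exact h1.ofReal_comp.add_const _

lemma wbCurve_continuous (σ : ℝ) : Continuous (wbCurve σ) := by
  unfold wbCurve; fun_prop

lemma wbCurveD_continuous (σ : ℝ) : Continuous (wbCurveD σ) := by
  unfold wbCurveD; fun_prop

lemma wbCurveD_norm (σ s : ℝ) (hσ : |σ| ≤ 1) : ‖wbCurveD σ s‖ ≤ 2 := by
  unfold wbCurveD
  refine (norm_add_le _ _).trans ?_
  rw [Complex.norm_real, Complex.norm_I, Real.norm_eq_abs, abs_neg, abs_mul, abs_div]
  have := Real.abs_sin_le_one s
  have h2 : |σ| * (|Real.sin s| / |2|) ≤ 1 * 1 := by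
    gcongr
    rw [abs_of_pos (by norm_num : (0:ℝ) < 2)]
    linarith
  linarith

lemma wb_cos_le (s : ℝ) (hs : |s| ≤ Real.pi / 2) : Real.cos s ≤ Real.pi / 2 - |s| := by
  rw [← Real.cos_abs, ← Real.sin_pi_div_two_sub]
  exact Real.sin_le (by linarith)

lemma wb_cos_ge (s : ℝ) (hs : |s| ≤ Real.pi / 2) : 1 - 2 / Real.pi * |s| ≤ Real.cos s := by
  rw [← Real.cos_abs]
  exact Real.one_sub_mul_le_cos (abs_nonneg _) hs

lemma wb_cos_pos (s : ℝ) (hs : |s| < Real.pi / 2) : 0 < Real.cos s := by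
  rw [abs_lt] at hs
  exact Real.cos_pos_of_mem_Ioo hs

lemma wb_norm_le (w : ℂ) (a b : ℝ) (h1 : |w.re| ≤ a) (h2 : |w.im| ≤ b) : ‖w‖ ≤ a + b :=
  (Complex.norm_le_abs_re_add_abs_im w).trans (add_le_add h1 h2)

/-- Points close to a curve point. -/
lemma wb_near (σ s : ℝ) (hσ : |σ| ≤ 1) (hs : |s| < Real.pi / 2) (w : ℂ)
    (hw : w ∈ Metric.ball (wbCurve σ s) ((Real.pi / 2 - |s|) / 4)) :
    |w.re - Real.pi / 2| < 3 / 4 * (Real.pi / 2 - |s|) ∧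
      |w.im - s| < (Real.pi / 2 - |s|) / 4 := by
  rw [Metric.mem_ball, dist_eq_norm] at hw
  have h1 := Complex.abs_re_le_norm (w - wbCurve σ s)
  have h2 := Complex.abs_im_le_norm (w - wbCurve σ s)
  rw [Complex.sub_re, wbCurve_re] at h1
  rw [Complex.sub_im, wbCurve_im] at h2
  refine ⟨?_, by linarith⟩
  have h3 : |σ * (Real.cos s / 2)| ≤ 1 * ((Real.pi / 2 - |s|) / 2) := by
    have := wb_cos_le s hs.le
    have := wb_cos_pos s hs
    rw [abs_mul, abs_of_pos (by positivity : 0 < Real.cos s / 2)]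
    gcongr
  have h4 := abs_add_le (w.re - (Real.pi / 2 + σ * (Real.cos s / 2))) (σ * (Real.cos s / 2))
  have h5 : w.re - (Real.pi / 2 + σ * (Real.cos s / 2)) + σ * (Real.cos s / 2) =
    w.re - Real.pi / 2 := by ring
  rw [h5] at h4
  linarith

lemma wb_near_mem (σ s : ℝ) (hσ : |σ| ≤ 1) (hs : |s| < Real.pi / 2) :
    Metric.ball (wbCurve σ s) ((Real.pi / 2 - |s|) / 4) ⊆ SquareD := by
  intro w hw
  obtain ⟨h1, h2⟩ := wb_near σ s hσ hs w hw
  rw [wb_mem_square]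
  have h3 := abs_add_le (w.im - s) s
  rw [sub_add_cancel] at h3
  linarith

lemma wbCurve_mem (σ s : ℝ) (hσ : |σ| ≤ 1) (hs : |s| < Real.pi / 2) :
    wbCurve σ s ∈ SquareD :=
  wb_near_mem σ s hσ hs (Metric.mem_ball_self (by linarith))

/-- `f` is bounded on the central cone. -/
lemma wb_bounded
    (z₀ z₁ : ℂ) (hz₀ : z₀ = ((Real.pi / 2 : ℝ) : ℂ) + ((Real.pi / 2 : ℝ) : ℂ) * Complex.I)
    (hz₁ : z₁ = ((Real.pi / 2 : ℝ) : ℂ) - ((Real.pi / 2 : ℝ) : ℂ) * Complex.I)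
    (f : ℂ → ℂ) (hf : DifferentiableOn ℂ f SquareD)
    (hint : ∫⁻ z in SquareD,
        ENNReal.ofReal (‖f z‖ ^ 2 / (‖z - z₀‖ ^ 2 * ‖z - z₁‖ ^ 2)) < ⊤) :
    ∃ M : ℝ, 0 ≤ M ∧ ∀ σ s : ℝ, |σ| ≤ 1 → |s| < Real.pi / 2 → ‖f (wbCurve σ s)‖ ≤ M := by
  set J := ∫⁻ z in SquareD,
        ENNReal.ofReal (‖f z‖ ^ 2 / (‖z - z₀‖ ^ 2 * ‖z - z₁‖ ^ 2)) with hJ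
  have hpi := Real.pi_lt_four
  have hz0r : z₀.re = Real.pi / 2 := by rw [hz₀]; simp
  have hz0i : z₀.im = Real.pi / 2 := by rw [hz₀]; simp
  have hz1r : z₁.re = Real.pi / 2 := by rw [hz₁]; simp
  have hz1i : z₁.im = -(Real.pi / 2) := by rw [hz₁]; simp
  refine ⟨Real.sqrt (10000 * J.toReal), Real.sqrt_nonneg _, fun σ s hσ hs => ?_⟩
  set d := Real.pi / 2 - |s| with hd
  have hdpos : 0 < d := by linarith
  have hd2 : d ≤ 2 := by have := abs_nonneg s; linarith
  have h1 := wb_mean_value f (wbCurve σ s) (d / 4) (by positivity)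
    (hf.mono (wb_near_mem σ s hσ hs))
  have h2 : ∫⁻ z in Metric.ball (wbCurve σ s) (d / 4), ENNReal.ofReal (‖f z‖ ^ 2) ≤
      ENNReal.ofReal (625 * d ^ 2) * J := by
    calc _ ≤ ∫⁻ z in Metric.ball (wbCurve σ s) (d / 4), ENNReal.ofReal (625 * d ^ 2) *
          ENNReal.ofReal (‖f z‖ ^ 2 / (‖z - z₀‖ ^ 2 * ‖z - z₁‖ ^ 2)) := by
          apply setLIntegral_mono' measurableSet_ball
          intro w hw
          rw [← ENNReal.ofReal_mul (by positivity)]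
          apply ENNReal.ofReal_le_ofReal
          have hD := wb_near_mem σ s hσ hs hw
          rw [wb_mem_square] at hD
          obtain ⟨hn1, hn2⟩ := wb_near σ s hσ hs w hw
          have hne0 : w - z₀ ≠ 0 := by
            intro h
            rw [sub_eq_zero] at h
            rw [h, hz0r, hz0i, abs_of_pos (by positivity : (0:ℝ) < Real.pi / 2)] at hD
            simp at hD
          have hne1 : w - z₁ ≠ 0 := by
            intro h
            rw [sub_eq_zero] at h
            rw [h, hz1r, hz1i, abs_neg, abs_of_pos (by positivity : (0:ℝ) < Real.pi / 2)] at hD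
            simp at hD
          have hre0 : |(w - z₀).re| ≤ 3 / 4 * d := by
            rw [Complex.sub_re, hz0r]; exact hn1.le
          have hre1 : |(w - z₁).re| ≤ 3 / 4 * d := by
            rw [Complex.sub_re, hz1r]; exact hn1.le
          rw [abs_lt] at hn2
          have hprod : ‖w - z₀‖ * ‖w - z₁‖ ≤ 25 * d := by
            rcases abs_cases s with ⟨h, h'⟩ | ⟨h, h'⟩
            · have a1 : ‖w - z₀‖ ≤ 3 / 4 * d + 5 / 4 * d := by
                apply wb_norm_le _ _ _ hre0
                rw [Complex.sub_im, hz0i, abs_le]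
                constructor <;> linarith
              have a2 : ‖w - z₁‖ ≤ 3 / 4 * d + 5 := by
                apply wb_norm_le _ _ _ hre1
                rw [Complex.sub_im, hz1i, abs_le]
                constructor <;> linarith
              calc _ ≤ (3 / 4 * d + 5 / 4 * d) * (3 / 4 * d + 5) := by gcongr
                _ ≤ _ := by nlinarith
            · have a1 : ‖w - z₁‖ ≤ 3 / 4 * d + 5 / 4 * d := by
                apply wb_norm_le _ _ _ hre1
                rw [Complex.sub_im, hz1i, abs_le]
                constructor <;> linarith
              have a2 : ‖w - z₀‖ ≤ 3 / 4 * d + 5 := by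
                apply wb_norm_le _ _ _ hre0
                rw [Complex.sub_im, hz0i, abs_le]
                constructor <;> linarith
              calc _ ≤ (3 / 4 * d + 5) * (3 / 4 * d + 5 / 4 * d) := by gcongr
                _ ≤ _ := by nlinarith
          have p0 : 0 < ‖w - z₀‖ := norm_pos_iff.2 hne0
          have p1 : 0 < ‖w - z₁‖ := norm_pos_iff.2 hne1
          rw [← mul_div_assoc, le_div_iff₀ (by positivity), ← mul_pow, mul_comm (_ * d ^ 2)]
          gcongr
          calc (‖w - z₀‖ * ‖w - z₁‖) ^ 2 ≤ (25 * d) ^ 2 := by gcongr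
            _ = _ := by ring
      _ = ENNReal.ofReal (625 * d ^ 2) * ∫⁻ z in Metric.ball (wbCurve σ s) (d / 4),
          ENNReal.ofReal (‖f z‖ ^ 2 / (‖z - z₀‖ ^ 2 * ‖z - z₁‖ ^ 2)) :=
          lintegral_const_mul' _ _ ENNReal.ofReal_ne_top
      _ ≤ _ := by
          gcongr
          exact lintegral_mono_set (wb_near_mem σ s hσ hs)
  have h3 := h1.trans h2
  rw [← ENNReal.ofReal_toReal hint.ne, ← ENNReal.ofReal_mul (by positivity),
    ENNReal.ofReal_le_ofReal_iff (by positivity)] at h3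
  apply Real.le_sqrt_of_sq_le
  have h4 : ‖f (wbCurve σ s)‖ ^ 2 * d ^ 2 ≤ (10000 * J.toReal) * d ^ 2 := by nlinarith
  exact le_of_mul_le_mul_right h4 (by positivity)

/-- The Cauchy integral along a curve. -/
def wbCauchy (σ : ℝ) (G : ℂ → ℂ) (z : ℂ) : ℂ :=
  (2 * (Real.pi : ℂ) * Complex.I)⁻¹ *
    ∫ s in (-(Real.pi / 2))..(Real.pi / 2), G (wbCurve σ s) * wbCurveD σ s / (wbCurve σ s - z)

lemma wb_integrable (G : ℂ → ℂ) (hG : DifferentiableOn ℂ G SquareD) (M : ℝ)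
    (hM : ∀ σ s : ℝ, |σ| ≤ 1 → |s| < Real.pi / 2 → ‖G (wbCurve σ s)‖ ≤ M)
    (σ : ℝ) (hσ : |σ| ≤ 1) :
    IntervalIntegrable (fun s => G (wbCurve σ s)) volume (-(Real.pi / 2)) (Real.pi / 2) := by
  have hpi := Real.pi_pos
  rw [intervalIntegrable_iff_integrableOn_Ioo_of_le (by linarith)]
  refine Integrable.of_bound ?_ M ?_
  · apply ContinuousOn.aestronglyMeasurable _ measurableSet_Ioo
    apply hG.continuousOn.comp (wbCurve_continuous σ).continuousOn
    intro s hs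
    exact wbCurve_mem σ s hσ (abs_lt.2 hs)
  · filter_upwards [ae_restrict_mem measurableSet_Ioo] with s hs
    exact hM σ s hσ (abs_lt.2 hs)

lemma wb_integrable_kernel (G : ℂ → ℂ) (hG : DifferentiableOn ℂ G SquareD) (M : ℝ)
    (hM : ∀ σ s : ℝ, |σ| ≤ 1 → |s| < Real.pi / 2 → ‖G (wbCurve σ s)‖ ≤ M)
    (σ : ℝ) (hσ : |σ| ≤ 1) (z : ℂ)
    (hz : ∀ s ∈ Icc (-(Real.pi / 2)) (Real.pi / 2), wbCurve σ s ≠ z) :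
    IntervalIntegrable (fun s => G (wbCurve σ s) * wbCurveD σ s / (wbCurve σ s - z))
      volume (-(Real.pi / 2)) (Real.pi / 2) := by
  have hpi := Real.pi_pos
  have h := (wb_integrable G hG M hM σ hσ).mul_continuousOn
    (g := fun s => wbCurveD σ s / (wbCurve σ s - z)) (by
      rw [uIcc_of_le (by linarith)]
      apply (wbCurveD_continuous σ).continuousOn.div
      · exact ((wbCurve_continuous σ).sub continuous_const).continuousOn
      · intro s hs
        exact sub_ne_zero.2 (hz s hs))
  convert h using 2
  ring

lemma wbCauchy_differentiableAt (G : ℂ → ℂ) (hG : DifferentiableOn ℂ G SquareD) (M : ℝ)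
    (hM : ∀ σ s : ℝ, |σ| ≤ 1 → |s| < Real.pi / 2 → ‖G (wbCurve σ s)‖ ≤ M)
    (σ : ℝ) (hσ : |σ| ≤ 1) (z : ℂ)
    (hz : ∀ s ∈ Icc (-(Real.pi / 2)) (Real.pi / 2), wbCurve σ s ≠ z) :
    DifferentiableAt ℂ (wbCauchy σ G) z := by
  have hpi := Real.pi_pos
  have hM0 : 0 ≤ M := (norm_nonneg _).trans (hM σ 0 hσ (by simp [hpi]))
  set Γ := wbCurve σ '' Icc (-(Real.pi / 2)) (Real.pi / 2) with hΓ
  have hΓc : IsClosed Γ := (isCompact_Icc.image (wbCurve_continuous σ)).isClosed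
  have hzΓ : z ∈ Γᶜ := by
    rintro ⟨s, hs, h⟩
    exact hz s hs h
  obtain ⟨ε, hε, hball⟩ := Metric.isOpen_iff.1 hΓc.isOpen_compl z hzΓ
  have hdist : ∀ x ∈ Metric.ball z (ε / 2), ∀ s ∈ Icc (-(Real.pi / 2)) (Real.pi / 2),
      ε / 2 ≤ ‖wbCurve σ s - x‖ := by
    intro x hx s hs
    by_contra! hlt
    have : wbCurve σ s ∈ Metric.ball z ε := by
      rw [Metric.mem_ball] at hx ⊢
      rw [← dist_eq_norm] at hlt
      linarith [dist_triangle (wbCurve σ s) x z]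
    exact hball this ⟨s, hs, rfl⟩
  have hne : ∀ x ∈ Metric.ball z (ε / 2), ∀ s ∈ Icc (-(Real.pi / 2)) (Real.pi / 2),
      wbCurve σ s - x ≠ 0 := by
    intro x hx s hs
    rw [← norm_pos_iff]
    exact lt_of_lt_of_le (by positivity) (hdist x hx s hs)
  have hint : ∀ x ∈ Metric.ball z (ε / 2),
      IntervalIntegrable (fun s => G (wbCurve σ s) * wbCurveD σ s / (wbCurve σ s - x))
      volume (-(Real.pi / 2)) (Real.pi / 2) := fun x hx =>
    wb_integrable_kernel G hG M hM σ hσ x (fun s hs => sub_ne_zero.1 (hne x hx s hs))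
  have hzb : z ∈ Metric.ball z (ε / 2) := Metric.mem_ball_self (by positivity)
  have hmem : Metric.ball z (ε / 2) ∈ nhds z := Metric.ball_mem_nhds _ (by positivity)
  have key := intervalIntegral.hasDerivAt_integral_of_dominated_loc_of_deriv_le
    (μ := volume) (a := -(Real.pi / 2)) (b := Real.pi / 2)
    (F := fun x s => G (wbCurve σ s) * wbCurveD σ s / (wbCurve σ s - x))
    (F' := fun x s => G (wbCurve σ s) * wbCurveD σ s / (wbCurve σ s - x) ^ 2)
    (x₀ := z) (s := Metric.ball z (ε / 2)) (bound := fun _ => M * 2 / (ε / 2) ^ 2)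
    hmem ?_ (hint z hzb) ?_ ?_ (by simp) ?_
  · unfold wbCauchy
    exact (key.2.differentiableAt).const_mul _
  · filter_upwards [hmem] with x hx
    have := (hint x hx).aestronglyMeasurable
    rwa [uIoc_of_le (by linarith)]
  · have h := (hint z hzb).mul_continuousOn (g := fun s => (wbCurve σ s - z)⁻¹) (by
      rw [uIcc_of_le (by linarith)]
      apply ContinuousOn.inv₀
      · exact ((wbCurve_continuous σ).sub continuous_const).continuousOn
      · intro s hs
        exact hne z hzb s hs)
    have h2 := h.aestronglyMeasurable
    rw [uIoc_of_le (by linarith)]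
    convert h2 using 2
    field_simp
  · have hae : ∀ᵐ t : ℝ, t ≠ Real.pi / 2 := by
      simp [ae_iff]
    filter_upwards [hae] with s hs1 hs2 x hx
    rw [uIoc_of_le (by linarith)] at hs2
    rw [norm_div, norm_mul, norm_pow]
    have a1 := hM σ s hσ (abs_lt.2 ⟨hs2.1, lt_of_le_of_ne hs2.2 hs1⟩)
    have a2 := wbCurveD_norm σ s hσ
    have a3 := hdist x hx s ⟨hs2.1.le, hs2.2⟩
    gcongr
  · refine Filter.Eventually.of_forall fun s hs2 x hx => ?_
    rw [uIoc_of_le (by linarith)] at hs2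
    have h0 := hne x hx s ⟨hs2.1.le, hs2.2⟩
    have h1 : HasDerivAt (fun x : ℂ => wbCurve σ s - x) (-1) x := by
      simpa using (hasDerivAt_id x).const_sub (wbCurve σ s)
    have h2 := (h1.inv h0).const_mul (G (wbCurve σ s) * wbCurveD σ s)
    simp only [div_eq_mul_inv]
    exact h2.congr_deriv (by simp)

/-- Off-curve criterion. -/
lemma wb_off_curve (σ : ℝ) (z : ℂ)
    (hz : 0 < -σ * (z.re - Real.pi / 2)) :
    ∀ s ∈ Icc (-(Real.pi / 2)) (Real.pi / 2), wbCurve σ s ≠ z := by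
  intro s hs h
  have h1 := wbCurve_re σ s
  rw [h] at h1
  have h2 := Real.cos_nonneg_of_mem_Icc hs
  rw [h1] at hz
  nlinarith [mul_nonneg (sq_nonneg σ) h2]

lemma wb_cos_integrable :
    IntervalIntegrable (fun s => (1 - 2 / Real.pi * |s|) ^ (-(3 / 4) : ℝ)) volume
      (-(Real.pi / 2)) (Real.pi / 2) := by
  have hpi := Real.pi_pos
  have h0 : IntervalIntegrable (fun x : ℝ => x ^ (-(3 / 4) : ℝ)) volume 1 0 :=
    intervalIntegral.intervalIntegrable_rpow' (by norm_num)
  have h1 := (h0.comp_sub_left 1)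
  have h2 := h1.comp_mul_left (c := 2 / Real.pi)
  have h3 : IntervalIntegrable (fun s => (1 - 2 / Real.pi * s) ^ (-(3 / 4) : ℝ)) volume
      0 (Real.pi / 2) := by
    convert h2 using 1 <;> simp
  have h4 : IntervalIntegrable (fun s => (1 - 2 / Real.pi * |s|) ^ (-(3 / 4) : ℝ)) volume
      0 (Real.pi / 2) := by
    refine h3.congr fun s hs => ?_
    rw [uIoc_of_le (by positivity)] at hs
    simp only [abs_of_pos hs.1]
  have h5 := (IntervalIntegrable.iff_comp_neg).1 h4
  simp only [abs_neg, neg_zero] at h5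
  exact h5.symm.trans h4

lemma wbCauchy_bound (G : ℂ → ℂ) (M : ℝ)
    (hM : ∀ σ s : ℝ, |σ| ≤ 1 → |s| < Real.pi / 2 → ‖G (wbCurve σ s)‖ ≤ M)
    (σ : ℝ) (hσ : σ ^ 2 = 1) :
    ∃ K : ℝ, 0 ≤ K ∧ ∀ z : ℂ, 0 < -σ * (z.re - Real.pi / 2) →
      ‖wbCauchy σ G z‖ ≤ K * (-σ * (z.re - Real.pi / 2)) ^ (-(1 / 4) : ℝ) := by
  have hpi := Real.pi_pos
  have hσ1 : |σ| = 1 := by rw [← sq_abs] at hσ; nlinarith [abs_nonneg σ]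
  have hM0 : 0 ≤ M := (norm_nonneg _).trans (hM σ 0 hσ1.le (by simp [hpi]))
  set A := ∫ s in (-(Real.pi / 2))..(Real.pi / 2),
    M * 2 * ((2:ℝ) * (1 - 2 / Real.pi * |s|) ^ (-(3 / 4) : ℝ)) with hA
  have hA0 : 0 ≤ A := by
    apply intervalIntegral.integral_nonneg (by linarith)
    intro s hs
    have : 0 ≤ 1 - 2 / Real.pi * |s| := by
      have h1 : |s| ≤ Real.pi / 2 := abs_le.2 hs
      have h2 : 2 / Real.pi * |s| ≤ 2 / Real.pi * (Real.pi / 2) := by gcongr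
      have h3 : 2 / Real.pi * (Real.pi / 2) = 1 := by field_simp
      linarith
    positivity
  refine ⟨‖(2 * (Real.pi : ℂ) * Complex.I)⁻¹‖ * A, by positivity, fun z hz => ?_⟩
  set u := -σ * (z.re - Real.pi / 2) with hu
  unfold wbCauchy
  rw [norm_mul, mul_assoc ‖(2 * (Real.pi : ℂ) * Complex.I)⁻¹‖ A]
  gcongr
  have hgi := (wb_cos_integrable.const_mul (2:ℝ)).const_mul (M * 2)
  have step := intervalIntegral.norm_integral_le_of_norm_le (μ := volume)
    (a := -(Real.pi / 2)) (b := Real.pi / 2)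
    (f := fun s => G (wbCurve σ s) * wbCurveD σ s / (wbCurve σ s - z))
    (g := fun s => M * 2 * (2 * (1 - 2 / Real.pi * |s|) ^ (-(3 / 4) : ℝ)) * u ^ (-(1 / 4) : ℝ))
    (by linarith) ?_ (hgi.mul_const _)
  · refine step.trans (le_of_eq ?_)
    rw [intervalIntegral.integral_mul_const]
  · have hae : ∀ᵐ t : ℝ, t ≠ Real.pi / 2 := by
      simp [ae_iff]
    filter_upwards [hae] with s hs1 hs2
    have hs : |s| < Real.pi / 2 := abs_lt.2 ⟨hs2.1, lt_of_le_of_ne hs2.2 hs1⟩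
    have a1 := hM σ s hσ1.le hs
    have a2 := wbCurveD_norm σ s hσ1.le
    set q := 1 - 2 / Real.pi * |s| with hq
    have hq0 : 0 < q := by
      have h2 : 2 / Real.pi * |s| < 2 / Real.pi * (Real.pi / 2) := by gcongr
      have h3 : 2 / Real.pi * (Real.pi / 2) = 1 := by field_simp
      linarith
    have hqc : q ≤ Real.cos s := wb_cos_ge s hs.le
    have a3 : q / 2 + u ≤ ‖wbCurve σ s - z‖ := by
      have h1 := Complex.abs_re_le_norm (wbCurve σ s - z)
      rw [Complex.sub_re, wbCurve_re] at h1
      have h2 : σ * (Real.pi / 2 + σ * (Real.cos s / 2) - z.re) ≤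
          |Real.pi / 2 + σ * (Real.cos s / 2) - z.re| := by
        refine (le_abs_self _).trans ?_
        rw [abs_mul, hσ1, one_mul]
      have h3 : σ * (Real.pi / 2 + σ * (Real.cos s / 2) - z.re) = Real.cos s / 2 + u := by
        rw [hu]; linear_combination (Real.cos s / 2) * hσ
      linarith
    have a4 : q ^ (3 / 4 : ℝ) * u ^ (1 / 4 : ℝ) ≤ q + u := by
      have hqu : 0 < q + u := by positivity
      calc q ^ (3 / 4 : ℝ) * u ^ (1 / 4 : ℝ) ≤ (q + u) ^ (3 / 4 : ℝ) * (q + u) ^ (1 / 4 : ℝ) := by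
            gcongr <;> linarith
        _ = q + u := by
            rw [← Real.rpow_add hqu]; norm_num
    have a5 : 1 / ‖wbCurve σ s - z‖ ≤ 2 * q ^ (-(3 / 4) : ℝ) * u ^ (-(1 / 4) : ℝ) := by
      rw [Real.rpow_neg hq0.le, Real.rpow_neg hz.le]
      have hp : 0 < q ^ (3 / 4 : ℝ) * u ^ (1 / 4 : ℝ) := by positivity
      calc 1 / ‖wbCurve σ s - z‖ ≤ 1 / ((q ^ (3 / 4 : ℝ) * u ^ (1 / 4 : ℝ)) / 2) := by
            apply one_div_le_one_div_of_le (by positivity)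
            linarith
        _ = _ := by field_simp
    rw [norm_div, norm_mul, div_eq_mul_one_div]
    calc ‖G (wbCurve σ s)‖ * ‖wbCurveD σ s‖ * (1 / ‖wbCurve σ s - z‖)
        ≤ M * 2 * (2 * q ^ (-(3 / 4) : ℝ) * u ^ (-(1 / 4) : ℝ)) := by gcongr
      _ = _ := by ring

lemma wb_log_sub_pos (w : ℂ) (hw : 0 < w.im) :
    Complex.log w - Complex.log (-w) = Real.pi * Complex.I := by
  apply Complex.ext
  · simp [Complex.log_re]
  · simp [Complex.log_im, Complex.arg_neg_eq_arg_sub_pi_of_im_pos hw]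

lemma wb_log_sub_neg (w : ℂ) (hw : w.im < 0) :
    Complex.log w - Complex.log (-w) = -(Real.pi * Complex.I) := by
  apply Complex.ext
  · simp [Complex.log_re]
  · simp [Complex.log_im, Complex.arg_neg_eq_arg_add_pi_of_im_neg hw]

lemma wb_curve_endpoint (σ : ℝ) : wbCurve σ (Real.pi / 2) = wbCurve 1 (Real.pi / 2) := by
  simp [wbCurve]

lemma wb_curve_endpoint' (σ : ℝ) : wbCurve σ (-(Real.pi / 2)) = wbCurve 1 (-(Real.pi / 2)) := by
  simp [wbCurve]

lemma wb_kite_off (z : ℂ) (h1 : |z.re - Real.pi / 2| < Real.cos z.im / 2)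
    (σ : ℝ) (hσ : |σ| = 1) (s : ℝ) : wbCurve σ s ≠ z := by
  intro h
  have hr := wbCurve_re σ s
  have hi := wbCurve_im σ s
  rw [h] at hr hi
  rw [← hi] at hr
  have : z.re - Real.pi / 2 = σ * (Real.cos z.im / 2) := by linarith
  rw [this, abs_mul, hσ, one_mul] at h1
  exact absurd h1 (not_lt.2 (le_abs_self _))

/-- Winding number computation. -/
lemma wb_winding (z : ℂ) (h1 : |z.re - Real.pi / 2| < Real.cos z.im / 2)
    (h2 : |z.im| < Real.pi / 2) :
    (∫ s in (-(Real.pi / 2))..(Real.pi / 2), wbCurveD 1 s / (wbCurve 1 s - z)) -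
    (∫ s in (-(Real.pi / 2))..(Real.pi / 2), wbCurveD (-1) s / (wbCurve (-1) s - z)) =
      2 * Real.pi * Complex.I := by
  have hpi := Real.pi_pos
  have hint : ∀ σ : ℝ, |σ| = 1 → IntervalIntegrable (fun s => wbCurveD σ s / (wbCurve σ s - z))
      volume (-(Real.pi / 2)) (Real.pi / 2) := by
    intro σ hσ
    apply Continuous.intervalIntegrable
    apply (wbCurveD_continuous σ).div ((wbCurve_continuous σ).sub continuous_const)
    intro s
    exact sub_ne_zero.2 (wb_kite_off z h1 σ hσ s)
  rw [abs_lt] at h1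
  have e1 := intervalIntegral.integral_eq_sub_of_hasDerivAt (a := -(Real.pi / 2))
    (b := Real.pi / 2) (f := fun s => Complex.log (wbCurve 1 s - z))
    (f' := fun s => wbCurveD 1 s / (wbCurve 1 s - z)) (by
      intro s _
      apply ((wbCurve_hasDerivAt 1 s).sub_const z).clog_real
      rw [Complex.mem_slitPlane_iff, Complex.sub_re, Complex.sub_im, wbCurve_re, wbCurve_im]
      by_cases hs : s = z.im
      · left; rw [hs]; linarith
      · right; exact sub_ne_zero.2 hs) (hint 1 (by simp))
  have e2 := intervalIntegral.integral_eq_sub_of_hasDerivAt (a := -(Real.pi / 2))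
    (b := Real.pi / 2) (f := fun s => Complex.log (-(wbCurve (-1) s - z)))
    (f' := fun s => wbCurveD (-1) s / (wbCurve (-1) s - z)) (by
      intro s _
      have := (((wbCurve_hasDerivAt (-1) s).sub_const z).neg).clog_real (by
        rw [Pi.neg_apply, Complex.mem_slitPlane_iff, Complex.neg_re, Complex.neg_im,
          Complex.sub_re, Complex.sub_im, wbCurve_re, wbCurve_im]
        by_cases hs : s = z.im
        · left; rw [hs]; linarith
        · right; exact neg_ne_zero.2 (sub_ne_zero.2 hs))
      refine this.congr_deriv ?_
      rw [Pi.neg_apply, neg_div_neg_eq]) (hint (-1) (by simp))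
  rw [e1, e2]
  simp only [wb_curve_endpoint (-1), wb_curve_endpoint' (-1)]
  rw [abs_lt] at h2
  have f1 := wb_log_sub_pos (wbCurve 1 (Real.pi / 2) - z) (by
    rw [Complex.sub_im, wbCurve_im]; linarith)
  have f2 := wb_log_sub_neg (wbCurve 1 (-(Real.pi / 2)) - z) (by
    rw [Complex.sub_im, wbCurve_im]; linarith)
  linear_combination f1 - f2

lemma wb_slope_integral (G : ℂ → ℂ) (hG : DifferentiableOn ℂ G SquareD) (M : ℝ)
    (hM : ∀ σ s : ℝ, |σ| ≤ 1 → |s| < Real.pi / 2 → ‖G (wbCurve σ s)‖ ≤ M)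
    (z : ℂ) (hz : z ∈ SquareD)
    (h2 : |z.im| < Real.pi / 2)
    (hint : IntervalIntegrable (fun s => dslope G z (wbCurve 1 s) * wbCurveD 1 s -
      dslope G z (wbCurve (-1) s) * wbCurveD (-1) s) volume (-(Real.pi / 2)) (Real.pi / 2)) :
    ∫ s in (-(Real.pi / 2))..(Real.pi / 2), (dslope G z (wbCurve 1 s) * wbCurveD 1 s -
      dslope G z (wbCurve (-1) s) * wbCurveD (-1) s) = 0 := by
  have hpi := Real.pi_pos
  have hM0 : 0 ≤ M := (norm_nonneg _).trans (hM 0 0 (by simp) (by simp [hpi]))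
  have hd : DifferentiableOn ℂ (dslope G z) SquareD :=
    (Complex.differentiableOn_dslope (wb_isOpen_square.mem_nhds hz)).2 hG
  obtain ⟨P, hP⟩ := wb_convex_square.exists_forall_hasDerivWithinAt hd
  replace hP : ∀ a ∈ SquareD, HasDerivAt P (dslope G z a) a := fun a ha =>
    (hP a ha).hasDerivAt (wb_isOpen_square.mem_nhds ha)
  set δ := (Real.pi / 2 - |z.im|) / 2 with hδ
  have hδ0 : 0 < δ := by linarith
  set B := (M + ‖G z‖) / δ with hB
  have hB0 : 0 ≤ B := by positivity
  -- bound on the slope near the ends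
  have hslope : ∀ σ s : ℝ, |σ| ≤ 1 → |s| < Real.pi / 2 → Real.pi / 2 - δ ≤ |s| →
      ‖dslope G z (wbCurve σ s)‖ ≤ B := by
    intro σ s hσ hs hs'
    have hdist : δ ≤ ‖wbCurve σ s - z‖ := by
      have a1 := Complex.abs_im_le_norm (wbCurve σ s - z)
      rw [Complex.sub_im, wbCurve_im] at a1
      have a2 := abs_sub_abs_le_abs_sub s z.im
      linarith
    have hne : wbCurve σ s ≠ z := by
      rw [← sub_ne_zero, ← norm_pos_iff]; linarith
    rw [dslope_of_ne _ hne, slope_def_field, norm_div]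
    have a3 := hM σ s hσ hs
    have a4 := norm_sub_le (G (wbCurve σ s)) (G z)
    rw [hB]
    gcongr
    linarith
  set Φ : ℝ → ℂ := fun s => P (wbCurve 1 s) - P (wbCurve (-1) s) with hΦ
  have hΦb : ∀ s : ℝ, |s| < Real.pi / 2 → Real.pi / 2 - δ ≤ |s| → ‖Φ s‖ ≤ B * Real.cos s := by
    intro s hs hs'
    have hc := wb_cos_pos s hs
    have := (convex_Icc (-1 : ℝ) 1).norm_image_sub_le_of_norm_hasDerivWithin_le
      (f := fun σ => P (wbCurve σ s))
      (f' := fun σ => dslope G z (wbCurve σ s) * ((Real.cos s / 2 : ℝ) : ℂ))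
      (C := B * (Real.cos s / 2)) (x := -1) (y := 1) (by
        intro σ hσ
        have hσ' : |σ| ≤ 1 := abs_le.2 hσ
        exact ((hP _ (wbCurve_mem σ s hσ' hs)).comp σ
          (wbCurve_hasDerivAt_param σ s)).hasDerivWithinAt) (by
        intro σ hσ
        have hσ' : |σ| ≤ 1 := abs_le.2 hσ
        rw [norm_mul, Complex.norm_real, Real.norm_of_nonneg (by positivity)]
        gcongr
        exact hslope σ s hσ' hs hs') (by simp) (by simp)
    refine this.trans (le_of_eq ?_)
    norm_num
    ring
  have hderiv : ∀ s ∈ Ioo (-(Real.pi / 2)) (Real.pi / 2),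
      HasDerivAt Φ (dslope G z (wbCurve 1 s) * wbCurveD 1 s -
      dslope G z (wbCurve (-1) s) * wbCurveD (-1) s) s := by
    intro s hs
    have hs' := abs_lt.2 hs
    have a1 := (hP _ (wbCurve_mem 1 s (by simp) hs')).comp s (wbCurve_hasDerivAt 1 s)
    have a2 := (hP _ (wbCurve_mem (-1) s (by simp) hs')).comp s (wbCurve_hasDerivAt (-1) s)
    exact a1.sub a2
  have hlim : ∀ (l : Filter ℝ) (e : ℝ), l ≤ nhds e → Real.cos e = 0 →
      (∀ᶠ s in l, |s| < Real.pi / 2 ∧ Real.pi / 2 - δ ≤ |s|) →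
      Filter.Tendsto Φ l (nhds 0) := by
    intro l e hl he hev
    apply squeeze_zero_norm' (a := fun s => B * Real.cos s)
    · filter_upwards [hev] with s hs
      exact hΦb s hs.1 hs.2
    · have : Filter.Tendsto (fun s => B * Real.cos s) (nhds e) (nhds (B * Real.cos e)) :=
        (continuous_const.mul Real.continuous_cos).tendsto e
      rw [he, mul_zero] at this
      exact this.mono_left hl
  have := intervalIntegral.integral_eq_sub_of_hasDerivAt_of_tendsto (by linarith) hderiv hint
    (fa := 0) (fb := 0)
    (hlim _ (-(Real.pi / 2)) nhdsWithin_le_nhds (by simp) (by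
      have : Ioo (-(Real.pi / 2)) (-(Real.pi / 2) + min δ (Real.pi / 2)) ∈
          nhdsWithin (-(Real.pi / 2)) (Ioi (-(Real.pi / 2))) :=
        Ioo_mem_nhdsGT (by have : 0 < min δ (Real.pi / 2) := by positivity
                           linarith)
      filter_upwards [this] with s hs
      have b1 := min_le_left δ (Real.pi / 2)
      have b2 := min_le_right δ (Real.pi / 2)
      have b3 : s < 0 := by linarith [hs.2]
      rw [abs_of_neg b3]
      constructor <;> linarith [hs.1, hs.2]))
    (hlim _ (Real.pi / 2) nhdsWithin_le_nhds (by simp) (by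
      have : Ioo (Real.pi / 2 - min δ (Real.pi / 2)) (Real.pi / 2) ∈
          nhdsWithin (Real.pi / 2) (Iio (Real.pi / 2)) :=
        Ioo_mem_nhdsLT (by have : 0 < min δ (Real.pi / 2) := by positivity
                           linarith)
      filter_upwards [this] with s hs
      have b1 := min_le_left δ (Real.pi / 2)
      have b2 := min_le_right δ (Real.pi / 2)
      have b3 : 0 < s := by linarith [hs.1]
      rw [abs_of_pos b3]
      constructor <;> linarith [hs.1, hs.2]))
  simpa using this

/-- The Cauchy integral formula between the two curves. -/
lemma wbCauchy_formula (G : ℂ → ℂ) (hG : DifferentiableOn ℂ G SquareD) (M : ℝ)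
    (hM : ∀ σ s : ℝ, |σ| ≤ 1 → |s| < Real.pi / 2 → ‖G (wbCurve σ s)‖ ≤ M)
    (z : ℂ) (h1 : |z.re - Real.pi / 2| < Real.cos z.im / 2)
    (h2 : |z.im| < Real.pi / 2) :
    wbCauchy 1 G z - wbCauchy (-1) G z = G z := by
  have hpi := Real.pi_pos
  have hz : z ∈ SquareD := by
    rw [wb_mem_square]
    have := wb_cos_le z.im h2.le
    have := wb_cos_pos z.im h2
    linarith
  have hk : ∀ σ : ℝ, |σ| = 1 → IntervalIntegrable
      (fun s => G (wbCurve σ s) * wbCurveD σ s / (wbCurve σ s - z))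
      volume (-(Real.pi / 2)) (Real.pi / 2) := fun σ hσ =>
    wb_integrable_kernel G hG M hM σ hσ.le z (fun s _ => wb_kite_off z h1 σ hσ s)
  have hc : ∀ σ : ℝ, |σ| = 1 → IntervalIntegrable
      (fun s => G z * (wbCurveD σ s / (wbCurve σ s - z)))
      volume (-(Real.pi / 2)) (Real.pi / 2) := by
    intro σ hσ
    apply Continuous.intervalIntegrable
    apply continuous_const.mul
    apply (wbCurveD_continuous σ).div ((wbCurve_continuous σ).sub continuous_const)
    intro s
    exact sub_ne_zero.2 (wb_kite_off z h1 σ hσ s)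
  have hs : ∀ σ : ℝ, |σ| = 1 → (fun s => dslope G z (wbCurve σ s) * wbCurveD σ s) =
      fun s => G (wbCurve σ s) * wbCurveD σ s / (wbCurve σ s - z) -
        G z * (wbCurveD σ s / (wbCurve σ s - z)) := by
    intro σ hσ
    funext s
    have hne := wb_kite_off z h1 σ hσ s
    rw [dslope_of_ne _ hne, slope_def_field]
    ring
  have hi : ∀ σ : ℝ, |σ| = 1 → IntervalIntegrable
      (fun s => dslope G z (wbCurve σ s) * wbCurveD σ s)
      volume (-(Real.pi / 2)) (Real.pi / 2) := by
    intro σ hσ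
    rw [hs σ hσ]
    exact (hk σ hσ).sub (hc σ hσ)
  have hv : ∀ σ : ℝ, |σ| = 1 →
      ∫ s in (-(Real.pi / 2))..(Real.pi / 2), dslope G z (wbCurve σ s) * wbCurveD σ s =
      (∫ s in (-(Real.pi / 2))..(Real.pi / 2),
        G (wbCurve σ s) * wbCurveD σ s / (wbCurve σ s - z)) -
      G z * ∫ s in (-(Real.pi / 2))..(Real.pi / 2), wbCurveD σ s / (wbCurve σ s - z) := by
    intro σ hσ
    rw [hs σ hσ, intervalIntegral.integral_sub (hk σ hσ) (hc σ hσ),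
      intervalIntegral.integral_const_mul]
  have p1 : |(1 : ℝ)| = 1 := by simp
  have p2 : |(-1 : ℝ)| = 1 := by simp
  have key := wb_slope_integral G hG M hM z hz h2 ((hi 1 p1).sub (hi (-1) p2))
  rw [intervalIntegral.integral_sub (hi 1 p1) (hi (-1) p2), hv 1 p1, hv (-1) p2] at key
  have hw := wb_winding z h1 h2
  have hne : (2 * (Real.pi : ℂ) * Complex.I) ≠ 0 := by
    simp [Real.pi_ne_zero]
  unfold wbCauchy
  rw [← mul_sub, inv_mul_eq_iff_eq_mul₀ hne]
  linear_combination key + G z * hw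

lemma wb_phi_integrableOn :
    IntegrableOn (fun v : ℝ => 2 * v ^ (-(1 / 2) : ℝ) / (Real.pi / 2 + v)) (Ioi 0) := by
  have hpi := Real.pi_gt_three
  have hmeas : ∀ S : Set ℝ, AEStronglyMeasurable
      (fun v : ℝ => 2 * v ^ (-(1 / 2) : ℝ) / (Real.pi / 2 + v)) (volume.restrict S) := by
    intro S
    apply Measurable.aestronglyMeasurable
    fun_prop
  rw [← Ioc_union_Ioi_eq_Ioi (zero_le_one' ℝ)]
  apply IntegrableOn.union
  · have h0 : IntervalIntegrable (fun x : ℝ => x ^ (-(1 / 2) : ℝ)) volume 0 1 :=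
      intervalIntegral.intervalIntegrable_rpow' (by norm_num)
    rw [intervalIntegrable_iff_integrableOn_Ioc_of_le zero_le_one] at h0
    refine Integrable.mono' (h0.const_mul 2) (hmeas _) ?_
    filter_upwards [ae_restrict_mem measurableSet_Ioc] with v hv
    have hv0 := hv.1
    rw [Real.norm_of_nonneg (by positivity)]
    apply div_le_self (by positivity)
    linarith
  · have h0 : IntegrableOn (fun x : ℝ => x ^ (-(3 / 2) : ℝ)) (Ioi 1) :=
      integrableOn_Ioi_rpow_of_lt (by norm_num) (by norm_num)
    refine Integrable.mono' (h0.const_mul 2) (hmeas _) ?_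
    filter_upwards [ae_restrict_mem measurableSet_Ioi] with v hv
    have hv1 : (1:ℝ) < v := hv
    have hv0 : 0 < v := by linarith
    rw [Real.norm_of_nonneg (by positivity)]
    have e : v ^ (-(3 / 2) : ℝ) = v ^ (-(1 / 2) : ℝ) / v := by
      rw [show (-(3 / 2) : ℝ) = -(1 / 2) - 1 by norm_num, Real.rpow_sub_one hv0.ne']
    rw [e, mul_div_assoc]
    gcongr
    linarith

lemma wb_phi_lintegral :
    ∫⁻ v : ℝ, ENNReal.ofReal (2 * |v| ^ (-(1 / 2) : ℝ) / (Real.pi / 2 + |v|)) < ⊤ := by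
  have hpi := Real.pi_pos
  have h1 : ∫⁻ v in Ioi (0:ℝ), ENNReal.ofReal (2 * |v| ^ (-(1 / 2) : ℝ) / (Real.pi / 2 + |v|))
      < ⊤ := by
    have h : IntegrableOn (fun v : ℝ => 2 * |v| ^ (-(1 / 2) : ℝ) / (Real.pi / 2 + |v|)) (Ioi 0) :=
      wb_phi_integrableOn.congr_fun (fun v hv => by
        simp only [abs_of_pos (show (0:ℝ) < v from hv)]) measurableSet_Ioi
    have := h.lintegral_lt_top
    exact this
  have h2 : ∫⁻ v in Iio (0:ℝ), ENNReal.ofReal (2 * |v| ^ (-(1 / 2) : ℝ) / (Real.pi / 2 + |v|))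
      < ⊤ := by
    have e := (Measure.measurePreserving_neg (volume : Measure ℝ)).setLIntegral_comp_preimage
      (s := Ioi 0) measurableSet_Ioi
      (f := fun v => ENNReal.ofReal (2 * |v| ^ (-(1 / 2) : ℝ) / (Real.pi / 2 + |v|)))
      (by fun_prop)
    have e2 : (Neg.neg ⁻¹' Ioi (0:ℝ)) = Iio 0 := by ext; simp
    rw [e2] at e
    simp only [abs_neg] at e
    rw [e]
    exact h1
  calc _ = ∫⁻ v in Iio 0 ∪ Ioi (0:ℝ),
        ENNReal.ofReal (2 * |v| ^ (-(1 / 2) : ℝ) / (Real.pi / 2 + |v|)) := by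
        rw [Iio_union_Ioi, restrict_compl_singleton]
    _ ≤ _ := lintegral_union_le _ _ _
    _ < ⊤ := ENNReal.add_lt_top.2 ⟨h2, h1⟩

/-- The union of the two sectors. -/
def wbOmega : Set ℂ := {z : ℂ | |z.im| < Real.pi / 2 + |z.re - Real.pi / 2|}

lemma wb_omega_lintegral :
    ∫⁻ z in wbOmega, ENNReal.ofReal (|z.re - Real.pi / 2| ^ (-(1 / 2) : ℝ) /
      (Real.pi / 2 + |z.re - Real.pi / 2|) ^ 2) < ⊤ := by
  have hpi := Real.pi_pos
  have hmO : MeasurableSet wbOmega := by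
    apply IsOpen.measurableSet
    exact isOpen_lt (by fun_prop) (by fun_prop)
  set ψ : ℝ → ENNReal := fun x => ENNReal.ofReal (|x - Real.pi / 2| ^ (-(1 / 2) : ℝ) /
      (Real.pi / 2 + |x - Real.pi / 2|) ^ 2) with hψ
  have hψm : Measurable ψ := by fun_prop
  set S : Set (ℝ × ℝ) := {p | |p.2| < Real.pi / 2 + |p.1 - Real.pi / 2|} with hS
  have hSm : MeasurableSet S := by
    apply IsOpen.measurableSet
    exact isOpen_lt (by fun_prop) (by fun_prop)
  have hHm : Measurable (S.indicator (fun p => ψ p.1)) :=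
    (hψm.comp measurable_fst).indicator hSm
  have e1 : ∫⁻ z in wbOmega, ψ z.re = ∫⁻ p : ℝ × ℝ, S.indicator (fun p => ψ p.1) p := by
    rw [← lintegral_indicator hmO,
      ← (Complex.volume_preserving_equiv_real_prod).lintegral_comp hHm]
    apply lintegral_congr
    intro z
    rfl
  change ∫⁻ z in wbOmega, ψ z.re < ⊤
  rw [e1, Measure.volume_eq_prod, lintegral_prod _ hHm.aemeasurable]
  have e2 : ∀ x : ℝ, ∫⁻ y : ℝ, S.indicator (fun p => ψ p.1) (x, y) =
      ENNReal.ofReal (2 * |x - Real.pi / 2| ^ (-(1 / 2) : ℝ) /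
        (Real.pi / 2 + |x - Real.pi / 2|)) := by
    intro x
    set R := Real.pi / 2 + |x - Real.pi / 2| with hR
    have hR0 : 0 < R := by positivity
    have : ∀ y : ℝ, S.indicator (fun p => ψ p.1) (x, y) =
        (Ioo (-R) R).indicator (fun _ => ψ x) y := by
      intro y
      by_cases hy : |y| < R
      · rw [indicator_of_mem (show (x, y) ∈ S from hy), 
          indicator_of_mem (show y ∈ Ioo (-R) R from abs_lt.1 hy)]
      · rw [indicator_of_notMem (show (x, y) ∉ S from hy),
          indicator_of_notMem (show y ∉ Ioo (-R) R from fun h => hy (abs_lt.2 h))]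
    simp only [this]
    rw [lintegral_indicator measurableSet_Ioo, setLIntegral_const, Real.volume_Ioo, hψ]
    simp only
    rw [← ENNReal.ofReal_mul (by positivity)]
    congr 1
    rw [← hR]
    field_simp
    ring
  simp only [e2]
  have := lintegral_sub_right_eq_self (μ := (volume : Measure ℝ))
    (fun v : ℝ => ENNReal.ofReal (2 * |v| ^ (-(1 / 2) : ℝ) / (Real.pi / 2 + |v|))) (Real.pi / 2)
  rw [this]
  exact wb_phi_lintegral

lemma wb_ae_re : ∀ᵐ z : ℂ, z.re ≠ Real.pi / 2 := by
  have h : ∀ᵐ p : ℝ × ℝ, p.1 ≠ Real.pi / 2 := by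
    rw [Measure.volume_eq_prod]
    have : ∀ᵐ t : ℝ, t ≠ Real.pi / 2 := by simp [ae_iff]
    exact Measure.quasiMeasurePreserving_fst.ae this
  exact Complex.volume_preserving_equiv_real_prod.quasiMeasurePreserving.ae h

lemma wb_sector_sub : SectorDelta ⊆ wbOmega := by
  intro z hz
  rw [wb_mem_sector] at hz
  have := le_abs_self (z.re - Real.pi / 2)
  change |z.im| < _
  linarith

lemma wb_piSector_sub : SectorPiDelta ⊆ wbOmega := by
  intro z hz
  rw [wb_mem_piSector] at hz
  have := neg_abs_le (z.re - Real.pi / 2)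
  change |z.im| < _
  linarith

/-- The pole of the auxiliary factor. -/
def wbPole : ℂ := ((Real.pi / 2 : ℝ) : ℂ) + (Real.pi : ℂ) * Complex.I

lemma wb_pole_dist (z : ℂ) (hz : z ∈ wbOmega) :
    (Real.pi / 2 + |z.re - Real.pi / 2|) / 4 ≤ ‖wbPole - z‖ := by
  have h1 := Complex.abs_re_le_norm (wbPole - z)
  have h2 := Complex.abs_im_le_norm (wbPole - z)
  have hr : (wbPole - z).re = -(z.re - Real.pi / 2) := by simp [wbPole]
  have hi : (wbPole - z).im = Real.pi - z.im := by simp [wbPole]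
  rw [hr, abs_neg] at h1
  rw [hi] at h2
  have h3 := le_abs_self (Real.pi - z.im)
  have h4 := le_abs_self z.im
  have h5 : |z.im| < Real.pi / 2 + |z.re - Real.pi / 2| := hz
  linarith [Real.pi_pos]

lemma wb_pole_ne (z : ℂ) (hz : z ∈ wbOmega) : wbPole - z ≠ 0 := by
  rw [← norm_pos_iff]
  have := wb_pole_dist z hz
  have : 0 < (Real.pi / 2 + |z.re - Real.pi / 2|) / 4 := by
    have := Real.pi_pos
    positivity
  linarith

lemma wb_square_lintegral
    (z₀ z₁ : ℂ) (hz₀ : z₀ = ((Real.pi / 2 : ℝ) : ℂ) + ((Real.pi / 2 : ℝ) : ℂ) * Complex.I)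
    (hz₁ : z₁ = ((Real.pi / 2 : ℝ) : ℂ) - ((Real.pi / 2 : ℝ) : ℂ) * Complex.I)
    (f : ℂ → ℂ)
    (hint : ∫⁻ z in SquareD,
        ENNReal.ofReal (‖f z‖ ^ 2 / (‖z - z₀‖ ^ 2 * ‖z - z₁‖ ^ 2)) < ⊤) :
    ∫⁻ z in SquareD, ENNReal.ofReal (‖f z‖ ^ 2) < ⊤ := by
  have hpi := Real.pi_lt_four
  have hz0r : z₀.re = Real.pi / 2 := by rw [hz₀]; simp
  have hz0i : z₀.im = Real.pi / 2 := by rw [hz₀]; simp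
  have hz1r : z₁.re = Real.pi / 2 := by rw [hz₁]; simp
  have hz1i : z₁.im = -(Real.pi / 2) := by rw [hz₁]; simp
  calc _ ≤ ∫⁻ z in SquareD, ENNReal.ofReal 10000 *
        ENNReal.ofReal (‖f z‖ ^ 2 / (‖z - z₀‖ ^ 2 * ‖z - z₁‖ ^ 2)) := by
        apply setLIntegral_mono' wb_isOpen_square.measurableSet
        intro w hD
        rw [← ENNReal.ofReal_mul (by positivity)]
        apply ENNReal.ofReal_le_ofReal
        rw [wb_mem_square] at hD
        have hne0 : w - z₀ ≠ 0 := by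
          intro h
          rw [sub_eq_zero] at h
          rw [h, hz0r, hz0i, abs_of_pos (by positivity : (0:ℝ) < Real.pi / 2)] at hD
          simp at hD
        have hne1 : w - z₁ ≠ 0 := by
          intro h
          rw [sub_eq_zero] at h
          rw [h, hz1r, hz1i, abs_neg, abs_of_pos (by positivity : (0:ℝ) < Real.pi / 2)] at hD
          simp at hD
        have b1 := abs_nonneg (w.re - Real.pi / 2)
        have b2 := abs_nonneg w.im
        have b3 := le_abs_self w.im
        have b4 := neg_abs_le w.im
        have a1 : ‖w - z₀‖ ≤ 2 + 8 := by
          apply wb_norm_le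
          · rw [Complex.sub_re, hz0r]; linarith
          · rw [Complex.sub_im, hz0i, abs_le]; constructor <;> linarith
        have a2 : ‖w - z₁‖ ≤ 2 + 8 := by
          apply wb_norm_le
          · rw [Complex.sub_re, hz1r]; linarith
          · rw [Complex.sub_im, hz1i, abs_le]; constructor <;> linarith
        have p0 : 0 < ‖w - z₀‖ := norm_pos_iff.2 hne0
        have p1 : 0 < ‖w - z₁‖ := norm_pos_iff.2 hne1
        rw [← mul_div_assoc, le_div_iff₀ (by positivity), mul_comm (10000 : ℝ)]
        gcongr
        calc ‖w - z₀‖ ^ 2 * ‖w - z₁‖ ^ 2 ≤ (2 + 8) ^ 2 * (2 + 8) ^ 2 := by gcongr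
          _ = _ := by norm_num
    _ = ENNReal.ofReal 10000 * ∫⁻ z in SquareD,
        ENNReal.ofReal (‖f z‖ ^ 2 / (‖z - z₀‖ ^ 2 * ‖z - z₁‖ ^ 2)) :=
        lintegral_const_mul' _ _ ENNReal.ofReal_ne_top
    _ < ⊤ := ENNReal.mul_lt_top ENNReal.ofReal_lt_top hint

/-- Square integrability from pointwise bounds. -/
lemma wb_l2 (f h : ℂ → ℂ)
    (hfi : ∫⁻ z in SquareD, ENNReal.ofReal (‖f z‖ ^ 2) < ⊤)
    (S : Set ℂ) (hSm : MeasurableSet S) (hS : S ⊆ wbOmega) (K : ℝ) (hK : 0 ≤ K)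
    (hb : ∀ z ∈ S, z.re ≠ Real.pi / 2 → ‖h z‖ ≤
      SquareD.indicator (fun z => ‖f z‖) z +
        K * |z.re - Real.pi / 2| ^ (-(1 / 4) : ℝ) / ‖wbPole - z‖) :
    ∫⁻ z in S, ENNReal.ofReal (‖h z‖ ^ 2) < ⊤ := by
  have hpi := Real.pi_pos
  set A : ℂ → ENNReal := SquareD.indicator (fun z => ENNReal.ofReal (‖f z‖ ^ 2)) with hA
  set Q : ℂ → ENNReal := fun z => ENNReal.ofReal (|z.re - Real.pi / 2| ^ (-(1 / 2) : ℝ) /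
      (Real.pi / 2 + |z.re - Real.pi / 2|) ^ 2) with hQ
  have hQm : Measurable Q := by fun_prop
  have hpt : ∀ᵐ z ∂(volume.restrict S), ENNReal.ofReal (‖h z‖ ^ 2) ≤
      ENNReal.ofReal 2 * A z + ENNReal.ofReal (32 * K ^ 2) * Q z := by
    filter_upwards [ae_restrict_mem hSm, ae_restrict_of_ae wb_ae_re] with z hz hre
    have h1 := hb z hz hre
    set v := |z.re - Real.pi / 2| with hv
    have hv0 : 0 < v := abs_pos.2 (sub_ne_zero.2 hre)
    have h2 := wb_pole_dist z (hS hz)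
    set t := SquareD.indicator (fun z => ‖f z‖) z with ht
    have hAz : A z = ENNReal.ofReal (t ^ 2) := by
      by_cases hzD : z ∈ SquareD
      · rw [hA, ht, indicator_of_mem hzD, indicator_of_mem hzD]
      · rw [hA, ht, indicator_of_notMem hzD, indicator_of_notMem hzD]; simp
    have ht0 : 0 ≤ t := indicator_nonneg (fun _ _ => norm_nonneg _) _
    rw [hAz, hQ]
    simp only
    rw [← ENNReal.ofReal_mul (by norm_num), ← ENNReal.ofReal_mul (by positivity),
      ← ENNReal.ofReal_add (by positivity) (by positivity)]
    apply ENNReal.ofReal_le_ofReal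
    have h3 : K * v ^ (-(1 / 4) : ℝ) / ‖wbPole - z‖ ≤
        K * v ^ (-(1 / 4) : ℝ) / ((Real.pi / 2 + v) / 4) := by
      gcongr
    have h4 : ‖h z‖ ≤ t + K * v ^ (-(1 / 4) : ℝ) / ((Real.pi / 2 + v) / 4) := by linarith
    have h5 : (v ^ (-(1 / 4) : ℝ)) ^ 2 = v ^ (-(1 / 2) : ℝ) := by
      rw [← Real.rpow_natCast, ← Real.rpow_mul hv0.le]; norm_num
    have h6 : (K * v ^ (-(1 / 4) : ℝ) / ((Real.pi / 2 + v) / 4)) ^ 2 =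
        16 * K ^ 2 * (v ^ (-(1 / 2) : ℝ) / (Real.pi / 2 + v) ^ 2) := by
      rw [← h5]; field_simp; norm_num
    calc ‖h z‖ ^ 2 ≤ (t + K * v ^ (-(1 / 4) : ℝ) / ((Real.pi / 2 + v) / 4)) ^ 2 := by gcongr
      _ ≤ 2 * t ^ 2 + 2 * (K * v ^ (-(1 / 4) : ℝ) / ((Real.pi / 2 + v) / 4)) ^ 2 := by
          nlinarith [sq_nonneg (t - K * v ^ (-(1 / 4) : ℝ) / ((Real.pi / 2 + v) / 4))]
      _ = _ := by rw [h6]; ring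
  calc _ ≤ ∫⁻ z in S, (ENNReal.ofReal 2 * A z + ENNReal.ofReal (32 * K ^ 2) * Q z) :=
        lintegral_mono_ae hpt
    _ = ENNReal.ofReal 2 * (∫⁻ z in S, A z) + ENNReal.ofReal (32 * K ^ 2) * ∫⁻ z in S, Q z := by
        rw [lintegral_add_right _ (hQm.const_mul _), lintegral_const_mul' _ _ ENNReal.ofReal_ne_top,
          lintegral_const_mul' _ _ ENNReal.ofReal_ne_top]
    _ < ⊤ := by
        apply ENNReal.add_lt_top.2 ⟨ENNReal.mul_lt_top ENNReal.ofReal_lt_top ?_,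
          ENNReal.mul_lt_top ENNReal.ofReal_lt_top ?_⟩
        · refine lt_of_le_of_lt (setLIntegral_le_lintegral _ _) ?_
          rw [hA, lintegral_indicator wb_isOpen_square.measurableSet]
          exact hfi
        · exact lt_of_le_of_lt (lintegral_mono_set hS) wb_omega_lintegral

lemma wb_glue (A B : ℂ → ℂ) (S : Set ℂ)
    (hA : ∀ z ∈ S, Real.pi / 2 < z.re → DifferentiableAt ℂ A z)
    (hB : ∀ z ∈ S, z.re < Real.pi / 2 → DifferentiableAt ℂ B z)
    (hmid : ∀ z ∈ S, z.re = Real.pi / 2 →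
      DifferentiableAt ℂ A z ∧ ∀ᶠ w in nhds z, A w = B w) (z : ℂ) (hz : z ∈ S) :
    DifferentiableAt ℂ (fun z => if Real.pi / 2 ≤ z.re then A z else B z) z := by
  rcases lt_trichotomy z.re (Real.pi / 2) with h | h | h
  · refine (hB z hz h).congr_of_eventuallyEq ?_
    have : ∀ᶠ w : ℂ in nhds z, w.re < Real.pi / 2 :=
      (isOpen_lt Complex.continuous_re continuous_const).mem_nhds h
    filter_upwards [this] with w hw
    rw [if_neg (not_le.2 hw)]
  · obtain ⟨h1, h2⟩ := hmid z hz h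
    refine h1.congr_of_eventuallyEq ?_
    filter_upwards [h2] with w hw
    split_ifs
    · rfl
    · exact hw.symm
  · refine (hA z hz h).congr_of_eventuallyEq ?_
    have : ∀ᶠ w : ℂ in nhds z, Real.pi / 2 < w.re :=
      (isOpen_lt continuous_const Complex.continuous_re).mem_nhds h
    filter_upwards [this] with w hw
    rw [if_pos hw.le]

lemma wb_kite_nhds (z : ℂ) (hre : z.re = Real.pi / 2) (him : |z.im| < Real.pi / 2) :
    ∀ᶠ w : ℂ in nhds z, |w.re - Real.pi / 2| < Real.cos w.im / 2 ∧ |w.im| < Real.pi / 2 := by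
  have h1 : IsOpen {w : ℂ | |w.re - Real.pi / 2| < Real.cos w.im / 2} :=
    isOpen_lt (by fun_prop) (by fun_prop)
  have h2 : IsOpen {w : ℂ | |w.im| < Real.pi / 2} := isOpen_lt (by fun_prop) (by fun_prop)
  refine (h1.inter h2).mem_nhds ⟨?_, him⟩
  have := wb_cos_pos z.im him
  change |z.re - Real.pi / 2| < _
  rw [hre]
  simpa using this

/-- If `f` is holomorphic on the square `D` and square integrable against the weight
`|z−z₀|⁻²|z−z₁|⁻²` (where `z₀, z₁` are the upper and lower vertices of `D`), then
`f ∈ A²(Δ) + A²(π − Δ)`. -/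
theorem weighted_bergman_subset_sum
    (z₀ z₁ : ℂ) (hz₀ : z₀ = ((Real.pi / 2 : ℝ) : ℂ) + ((Real.pi / 2 : ℝ) : ℂ) * Complex.I)
    (hz₁ : z₁ = ((Real.pi / 2 : ℝ) : ℂ) - ((Real.pi / 2 : ℝ) : ℂ) * Complex.I)
    (f : ℂ → ℂ) (hf : DifferentiableOn ℂ f SquareD)
    (hint : ∫⁻ z in SquareD,
        ENNReal.ofReal (‖f z‖ ^ 2 / (‖z - z₀‖ ^ 2 * ‖z - z₁‖ ^ 2)) < ⊤) :
    ∃ f₁ f₂ : ℂ → ℂ, MemA2 SectorDelta f₁ ∧ MemA2 SectorPiDelta f₂ ∧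
      ∀ z ∈ SquareD, f z = f₁ z + f₂ z := by
  obtain ⟨M, hM0, hM⟩ := wb_bounded z₀ z₁ hz₀ hz₁ f hf hint
  have hfi := wb_square_lintegral z₀ z₁ hz₀ hz₁ f hint
  have hpi := Real.pi_pos
  have hpi4 := Real.pi_lt_four
  set G : ℂ → ℂ := fun z => (wbPole - z) * f z with hGdef
  have hG : DifferentiableOn ℂ G SquareD :=
    ((differentiable_const _).sub differentiable_id).differentiableOn.mul hf
  have hMG : ∀ σ s : ℝ, |σ| ≤ 1 → |s| < Real.pi / 2 → ‖G (wbCurve σ s)‖ ≤ (1 + 8) * M := by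
    intro σ s hσ hs
    simp only [hGdef, norm_mul]
    refine mul_le_mul ?_ (hM σ s hσ hs) (norm_nonneg _) (by norm_num)
    apply wb_norm_le
    · have e : (wbPole - wbCurve σ s).re = -(σ * (Real.cos s / 2)) := by
        rw [Complex.sub_re, wbCurve_re]; simp [wbPole]
      rw [e, abs_neg, abs_mul, abs_div]
      have h1 := Real.abs_cos_le_one s
      have h2 : |Real.cos s| / |2| ≤ 1 := by
        rw [abs_of_pos (by norm_num : (0:ℝ) < 2)]; linarith
      exact mul_le_one₀ hσ (by positivity) h2
    · have e : (wbPole - wbCurve σ s).im = Real.pi - s := by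
        rw [Complex.sub_im, wbCurve_im]; simp [wbPole]
      rw [abs_lt] at hs
      rw [e, abs_le]
      constructor <;> linarith
  obtain ⟨K₁, hK₁, hb₁⟩ := wbCauchy_bound G _ hMG 1 (by norm_num)
  obtain ⟨K₂, hK₂, hb₂⟩ := wbCauchy_bound G _ hMG (-1) (by norm_num)
  -- differentiability of the pieces
  have hd1 : ∀ z : ℂ, z.re < Real.pi / 2 → DifferentiableAt ℂ (wbCauchy 1 G) z := fun z hz =>
    wbCauchy_differentiableAt G hG _ hMG 1 (by norm_num) z (wb_off_curve 1 z (by linarith))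
  have hd2 : ∀ z : ℂ, Real.pi / 2 < z.re → DifferentiableAt ℂ (wbCauchy (-1) G) z := fun z hz =>
    wbCauchy_differentiableAt G hG _ hMG (-1) (by norm_num) z (wb_off_curve (-1) z (by linarith))
  have hGd : ∀ z ∈ SquareD, DifferentiableAt ℂ G z := fun z hz =>
    (hG z hz).differentiableAt (wb_isOpen_square.mem_nhds hz)
  have hd3 : ∀ z : ℂ, z.re = Real.pi / 2 → |z.im| < Real.pi / 2 →
      DifferentiableAt ℂ (wbCauchy (-1) G) z := by
    intro z hre him
    have h := (wb_kite_nhds z hre him).self_of_nhds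
    exact wbCauchy_differentiableAt G hG _ hMG (-1) (by norm_num) z
      (fun s _ => wb_kite_off z h.1 (-1) (by norm_num) s)
  have hform : ∀ z : ℂ, z.re = Real.pi / 2 → |z.im| < Real.pi / 2 →
      ∀ᶠ w in nhds z, wbCauchy 1 G w - wbCauchy (-1) G w = G w := by
    intro z hre him
    filter_upwards [wb_kite_nhds z hre him] with w hw
    exact wbCauchy_formula G hG _ hMG w hw.1 hw.2
  have hsqL : ∀ z ∈ SectorDelta, z.re < Real.pi / 2 → z ∈ SquareD := by
    intro z hz hre
    rw [wb_mem_sector] at hz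
    rw [wb_mem_square, abs_of_neg (by linarith)]
    linarith
  have hsqR : ∀ z ∈ SectorPiDelta, Real.pi / 2 < z.re → z ∈ SquareD := by
    intro z hz hre
    rw [wb_mem_piSector] at hz
    rw [wb_mem_square, abs_of_pos (by linarith)]
    linarith
  have hmidsq : ∀ z : ℂ, z.re = Real.pi / 2 → |z.im| < Real.pi / 2 → z ∈ SquareD := by
    intro z hre him
    rw [wb_mem_square, hre]
    simpa using him
  have hpole : ∀ z : ℂ, DifferentiableAt ℂ (fun z : ℂ => wbPole - z) z := fun z =>
    ((differentiable_const _).sub differentiable_id) z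
  have hnG : ∀ z ∈ SquareD, ‖G z‖ / ‖wbPole - z‖ = ‖f z‖ := by
    intro z hz
    have : ‖wbPole - z‖ ≠ 0 := norm_ne_zero_iff.2 (wb_pole_ne z (wb_sector_sub hz.1))
    simp only [hGdef, norm_mul]
    field_simp
  -- bounds of the pieces
  have hbL : ∀ z : ℂ, z.re < Real.pi / 2 → ‖wbCauchy 1 G z‖ ≤
      (K₁ + K₂) * |z.re - Real.pi / 2| ^ (-(1 / 4) : ℝ) := by
    intro z hz
    have h := hb₁ z (by linarith)
    rw [show -1 * (z.re - Real.pi / 2) = |z.re - Real.pi / 2| by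
      rw [abs_of_neg (by linarith)]; ring] at h
    refine h.trans ?_
    gcongr
    linarith
  have hbR : ∀ z : ℂ, Real.pi / 2 < z.re → ‖wbCauchy (-1) G z‖ ≤
      (K₁ + K₂) * |z.re - Real.pi / 2| ^ (-(1 / 4) : ℝ) := by
    intro z hz
    have h := hb₂ z (by linarith)
    rw [show -(-1) * (z.re - Real.pi / 2) = |z.re - Real.pi / 2| by
      rw [abs_of_pos (by linarith)]; ring] at h
    refine h.trans ?_
    gcongr
    linarith
  have hind : ∀ z : ℂ, 0 ≤ SquareD.indicator (fun z => ‖f z‖) z := fun z =>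
    indicator_nonneg (fun _ _ => norm_nonneg _) _
  refine ⟨fun z => (if Real.pi / 2 ≤ z.re then -wbCauchy (-1) G z else G z - wbCauchy 1 G z) /
      (wbPole - z),
    fun z => (if Real.pi / 2 ≤ z.re then G z + wbCauchy (-1) G z else wbCauchy 1 G z) /
      (wbPole - z), ⟨?_, ?_⟩, ⟨?_, ?_⟩, ?_⟩
  · intro z hz
    refine (DifferentiableAt.div ?_ (hpole z)
      (wb_pole_ne z (wb_sector_sub hz))).differentiableWithinAt
    refine wb_glue (fun z => -wbCauchy (-1) G z) (fun z => G z - wbCauchy 1 G z) SectorDelta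
      ?_ ?_ ?_ z hz
    · intro w _ hre
      exact (hd2 w hre).neg
    · intro w hw hre
      exact (hGd w (hsqL w hw hre)).sub (hd1 w hre)
    · intro w hw hre
      have him : |w.im| < Real.pi / 2 := by
        rw [wb_mem_sector] at hw; linarith
      refine ⟨(hd3 w hre him).neg, ?_⟩
      filter_upwards [hform w hre him] with u hu
      rw [← hu]; ring
  · refine wb_l2 f _ hfi SectorDelta wb_isOpen_sector.measurableSet wb_sector_sub (K₁ + K₂)
      (by positivity) ?_
    intro z hz hre
    simp only [norm_div]
    rcases lt_or_gt_of_ne hre with h | h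
    · have hD := hsqL z hz h
      rw [if_neg (not_le.2 h), indicator_of_mem hD, ← hnG z hD, ← add_div]
      gcongr
      exact (norm_sub_le _ _).trans (by gcongr; exact hbL z h)
    · rw [if_pos h.le, norm_neg]
      refine le_add_of_nonneg_of_le (hind z) ?_
      gcongr
      exact hbR z h
  · intro z hz
    refine (DifferentiableAt.div ?_ (hpole z)
      (wb_pole_ne z (wb_piSector_sub hz))).differentiableWithinAt
    refine wb_glue (fun z => G z + wbCauchy (-1) G z) (fun z => wbCauchy 1 G z) SectorPiDelta
      ?_ ?_ ?_ z hz
    · intro w hw hre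
      exact (hGd w (hsqR w hw hre)).add (hd2 w hre)
    · intro w _ hre
      exact hd1 w hre
    · intro w hw hre
      have him : |w.im| < Real.pi / 2 := by
        rw [wb_mem_piSector] at hw; linarith
      refine ⟨(hGd w (hmidsq w hre him)).add (hd3 w hre him), ?_⟩
      filter_upwards [hform w hre him] with u hu
      rw [← hu]; ring
  · refine wb_l2 f _ hfi SectorPiDelta wb_isOpen_piSector.measurableSet wb_piSector_sub (K₁ + K₂)
      (by positivity) ?_
    intro z hz hre
    simp only [norm_div]
    rcases lt_or_gt_of_ne hre with h | h
    · rw [if_neg (not_le.2 h)]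
      refine le_add_of_nonneg_of_le (hind z) ?_
      gcongr
      exact hbL z h
    · have hD := hsqR z hz h
      rw [if_pos h.le, indicator_of_mem hD, ← hnG z hD, ← add_div]
      gcongr
      exact (norm_add_le _ _).trans (by gcongr; exact hbR z h)
  · intro z hz
    have hne := wb_pole_ne z (wb_sector_sub hz.1)
    have e : f z = G z / (wbPole - z) := by
      simp only [hGdef]
      field_simp
    rw [e]
    simp only
    split_ifs <;> ring

end
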